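/- Let k ≥ 2, let 0 < s < r < 1 with r² < s, let δ > 0, and let (F_j)_{j ≥ 1} be a sequence of holomorphic automorphisms of ℂ^k fixing the origin with s‖z‖ ≤ ‖F_j(z)‖ ≤ r‖z‖ for all z in the open ball B_δ and all j. Then each derivative A_j = dF_j(0) is invertible, and the sequence of maps Φ_j = A(j)⁻¹ ∘ F(j), where F(j) = F_j ∘ ⋯ ∘ F_1 and A(j) = A_j ∘ ⋯ ∘ A_1, converges uniformly on compact subsets of the basin Ω⁰_{(F_j)} = {z : F(j)(z) → 0} to a holomorphic map Φ : Ω⁰_{(F_j)} → ℂ^k whose derivative at 0 is the identity and which is injective on Ω⁰_{(F_j)}. -/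

import Mathlib

open Metric Set Filter

noncomputable section

/-- A holomorphic automorphism of `ℂ^k`: a holomorphic bijection with holomorphic inverse. -/
def IsAutomorphism {k : ℕ} (F : EuclideanSpace ℂ (Fin k) → EuclideanSpace ℂ (Fin k)) : Prop :=
  Differentiable ℂ F ∧ ∃ G : EuclideanSpace ℂ (Fin k) → EuclideanSpace ℂ (Fin k),
    Differentiable ℂ G ∧ Function.LeftInverse G F ∧ Function.RightInverse G F

/-- `seqComp F j = F j ∘ ⋯ ∘ F 1`, with `seqComp F 0 = id`. -/
def seqComp {α : Type*} (F : ℕ → α → α) : ℕ → α → α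
  | 0 => id
  | n + 1 => F (n + 1) ∘ seqComp F n

/-- `equivComp A j = A j ∘ ⋯ ∘ A 1` as a continuous linear equivalence,
with `equivComp A 0 = id`. -/
def equivComp {E : Type*} [NormedAddCommGroup E] [NormedSpace ℂ E]
    (A : ℕ → E ≃L[ℂ] E) : ℕ → E ≃L[ℂ] E
  | 0 => ContinuousLinearEquiv.refl ℂ E
  | n + 1 => (equivComp A n).trans (A (n + 1))

open Topology

section Helpers

variable {E : Type*} [NormedAddCommGroup E] [NormedSpace ℂ E]

/-- The derivative at the origin inherits the two-sided norm bounds. -/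
theorem deriv_bounds {f : E → E} {A : E →L[ℂ] E} {s r δ : ℝ} (hδ : 0 < δ)
    (h0 : f 0 = 0) (hA : HasFDerivAt f A 0)
    (hb : ∀ z ∈ Metric.ball (0 : E) δ, s * ‖z‖ ≤ ‖f z‖ ∧ ‖f z‖ ≤ r * ‖z‖) (v : E) :
    s * ‖v‖ ≤ ‖A v‖ ∧ ‖A v‖ ≤ r * ‖v‖ := by
  have hc : Tendsto (fun n : ℕ => ‖(n : ℂ)‖) atTop atTop := by
    simpa using tendsto_natCast_atTop_atTop (R := ℝ)
  have hlim := (hA.lim v (c := fun n : ℕ => (n : ℂ)) hc).norm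
  have hz : Tendsto (fun n : ℕ => ((n : ℂ)⁻¹) • v) atTop (𝓝 0) := by
    have := (tendsto_inv_atTop_nhds_zero_nat (𝕜 := ℂ)).smul_const v
    simpa using this
  have hev : ∀ᶠ n : ℕ in atTop,
      s * ‖v‖ ≤ ‖(n : ℂ) • (f (0 + ((n : ℂ)⁻¹) • v) - f 0)‖ ∧
      ‖(n : ℂ) • (f (0 + ((n : ℂ)⁻¹) • v) - f 0)‖ ≤ r * ‖v‖ := by
    filter_upwards [hz.eventually (Metric.ball_mem_nhds 0 hδ), eventually_gt_atTop 0] with n hn hpos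
    have hn0 : (0 : ℝ) < n := by exact_mod_cast hpos
    obtain ⟨h1, h2⟩ := hb _ hn
    rw [norm_smul, norm_inv, Complex.norm_natCast] at h1 h2
    rw [zero_add, h0, sub_zero, norm_smul, Complex.norm_natCast]
    constructor
    · calc s * ‖v‖ = n * (s * ((n : ℝ)⁻¹ * ‖v‖)) := by field_simp
        _ ≤ _ := by gcongr
    · calc _ ≤ n * (r * ((n : ℝ)⁻¹ * ‖v‖)) := by gcongr
        _ = r * ‖v‖ := by field_simp
  exact ⟨ge_of_tendsto hlim (hev.mono fun n h => h.1), le_of_tendsto hlim (hev.mono fun n h => h.2)⟩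

/-- Quadratic remainder estimate. -/
theorem quad_bound {f : E → E} {A : E →L[ℂ] E} {s r δ : ℝ} (hδ : 0 < δ) (hr : 0 < r)
    (hf : Differentiable ℂ f) (h0 : f 0 = 0) (hA : HasFDerivAt f A 0)
    (hb : ∀ z ∈ Metric.ball (0 : E) δ, s * ‖z‖ ≤ ‖f z‖ ∧ ‖f z‖ ≤ r * ‖z‖)
    {z : E} (hz : z ∈ Metric.ball (0 : E) δ) :
    ‖f z - A z‖ ≤ (2 * r / δ) * ‖z‖ ^ 2 := by
  have key := Complex.dist_le_mul_div_pow_of_mapsTo_ball_of_isLittleO (n := 1)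
    (f := fun w => f w - A w) (c := 0) (z := z) (R₁ := δ) (R₂ := 2 * r * δ)
    (by fun_prop)
    (by
      intro w hw
      have h1 := (hb w hw).2
      have h2 := (deriv_bounds hδ h0 hA hb w).2
      have h3 : ‖w‖ < δ := by simpa using hw
      simp only [h0, map_zero, sub_zero, mem_closedBall, dist_zero_right]
      calc _ ≤ ‖f w‖ + ‖A w‖ := norm_sub_le _ _
        _ ≤ 2 * r * ‖w‖ := by linarith
        _ ≤ _ := by gcongr)
    (by
      have := hA.isLittleO
      simp only [h0, map_zero, sub_zero, pow_one] at this ⊢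
      exact this.norm_right)
    hz
  simp only [h0, map_zero, sub_zero, dist_zero_right] at key
  refine key.trans (le_of_eq ?_)
  rw [div_pow]
  field_simp

/-- Standing hypotheses. -/
def Good (s r δ : ℝ) (F : ℕ → E → E) (A : ℕ → E ≃L[ℂ] E) : Prop :=
  ∀ j, 1 ≤ j → Differentiable ℂ (F j) ∧ F j 0 = 0 ∧
    HasFDerivAt (F j) (A j : E →L[ℂ] E) 0 ∧
    ∀ z ∈ Metric.ball (0 : E) δ, s * ‖z‖ ≤ ‖F j z‖ ∧ ‖F j z‖ ≤ r * ‖z‖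

theorem Good.shift {s r δ : ℝ} {F : ℕ → E → E} {A : ℕ → E ≃L[ℂ] E} (h : Good s r δ F A) (m : ℕ) :
    Good s r δ (fun j => F (m + j)) (fun j => A (m + j)) :=
  fun j hj => h (m + j) (by omega)

theorem seqComp_add {α : Type*} (F : ℕ → α → α) (m n : ℕ) (z : α) :
    seqComp F (m + n) z = seqComp (fun j => F (m + j)) n (seqComp F m z) := by
  induction n with
  | zero => rfl
  | succ n ih =>
    show F (m + n + 1) (seqComp F (m + n) z) = _
    rw [ih]; rfl

theorem equivComp_add (A : ℕ → E ≃L[ℂ] E) (m n : ℕ) (z : E) :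
    (equivComp A (m + n)).symm z
      = (equivComp A m).symm ((equivComp (fun j => A (m + j)) n).symm z) := by
  induction n generalizing z with
  | zero => rfl
  | succ n ih =>
    show (equivComp A (m + n)).symm ((A (m + n + 1)).symm z) = _
    rw [ih]; rfl

/-- The normalized compositions. -/
def nrm (F : ℕ → E → E) (A : ℕ → E ≃L[ℂ] E) (n : ℕ) (z : E) : E :=
  (equivComp A n).symm (seqComp F n z)

theorem nrm_add (F : ℕ → E → E) (A : ℕ → E ≃L[ℂ] E) (m n : ℕ) (z : E) :
    nrm F A (m + n) z = (equivComp A m).symm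
      (nrm (fun j => F (m + j)) (fun j => A (m + j)) n (seqComp F m z)) := by
  simp only [nrm, seqComp_add, equivComp_add]

variable {s r δ : ℝ} {F : ℕ → E → E} {A : ℕ → E ≃L[ℂ] E}

theorem Good.seq_diff (h : Good s r δ F A) (n : ℕ) : Differentiable ℂ (seqComp F n) := by
  induction n with
  | zero => exact differentiable_id
  | succ n ih => exact (h (n + 1) (by omega)).1.comp ih

theorem Good.seq_zero (h : Good s r δ F A) (n : ℕ) : seqComp F n 0 = 0 := by
  induction n with
  | zero => rfl
  | succ n ih =>
    show F (n + 1) (seqComp F n 0) = 0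
    rw [ih]; exact (h (n + 1) (by omega)).2.1

theorem Good.nrm_diff (h : Good s r δ F A) (n : ℕ) : Differentiable ℂ (nrm F A n) :=
  (equivComp A n).symm.differentiable.comp (h.seq_diff n)

theorem Good.seq_fderiv (h : Good s r δ F A) (n : ℕ) :
    HasFDerivAt (seqComp F n) (equivComp A n : E →L[ℂ] E) 0 := by
  induction n with
  | zero => exact hasFDerivAt_id 0
  | succ n ih =>
    have h1 := (h (n + 1) (by omega)).2.2.1
    rw [← h.seq_zero n] at h1
    exact h1.comp 0 ih

theorem Good.nrm_fderiv (h : Good s r δ F A) (n : ℕ) :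
    HasFDerivAt (nrm F A n) (ContinuousLinearMap.id ℂ E) 0 := by
  have := (equivComp A n).symm.hasFDerivAt.comp (0 : E) (h.seq_fderiv n)
  rwa [ContinuousLinearEquiv.coe_symm_comp_coe] at this

theorem Good.seq_bound (h : Good s r δ F A) (hr : 0 < r) (hr1 : r < 1) (n : ℕ) {z : E}
    (hz : z ∈ Metric.ball (0 : E) δ) : ‖seqComp F n z‖ ≤ r ^ n * ‖z‖ := by
  induction n with
  | zero => simp [seqComp]
  | succ n ih =>
    have hz' : ‖z‖ < δ := by simpa using hz
    have hle : r ^ n * ‖z‖ ≤ ‖z‖ :=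
      mul_le_of_le_one_left (norm_nonneg _) (pow_le_one₀ hr.le hr1.le)
    have hm : seqComp F n z ∈ Metric.ball (0 : E) δ := by
      rw [mem_ball_zero_iff]; linarith
    calc ‖F (n + 1) (seqComp F n z)‖ ≤ r * ‖seqComp F n z‖ :=
          ((h (n + 1) (by omega)).2.2.2 _ hm).2
      _ ≤ r * (r ^ n * ‖z‖) := by gcongr
      _ = _ := by ring

theorem Good.symm_bound (h : Good s r δ F A) (hδ : 0 < δ) (hs : 0 < s) (n : ℕ) (v : E) :
    ‖(equivComp A n).symm v‖ ≤ (s ^ n)⁻¹ * ‖v‖ := by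
  induction n generalizing v with
  | zero => simp [equivComp]
  | succ n ih =>
    obtain ⟨h1, h2, h3, h4⟩ := h (n + 1) (by omega)
    have h5 := (deriv_bounds hδ h2 h3 h4 ((A (n + 1)).symm v)).1
    simp only [ContinuousLinearEquiv.coe_coe, ContinuousLinearEquiv.apply_symm_apply] at h5
    calc ‖(equivComp A n).symm ((A (n + 1)).symm v)‖
        ≤ (s ^ n)⁻¹ * ‖(A (n + 1)).symm v‖ := ih _
      _ ≤ (s ^ n)⁻¹ * (‖v‖ / s) := by
          gcongr
          rw [le_div_iff₀ hs]; linarith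
      _ = _ := by rw [pow_succ]; field_simp

theorem Good.step (h : Good s r δ F A) (hδ : 0 < δ) (hs : 0 < s) (hr : 0 < r) (hr1 : r < 1)
    (n : ℕ) {z : E} (hz : z ∈ Metric.ball (0 : E) δ) :
    ‖nrm F A (n + 1) z - nrm F A n z‖ ≤ 2 * r / δ / s * ‖z‖ ^ 2 * (r ^ 2 / s) ^ n := by
  obtain ⟨h1, h2, h3, h4⟩ := h (n + 1) (by omega)
  have hz' : ‖z‖ < δ := by simpa using hz
  have hb := h.seq_bound hr hr1 n hz
  have hle : r ^ n * ‖z‖ ≤ ‖z‖ :=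
    mul_le_of_le_one_left (norm_nonneg _) (pow_le_one₀ hr.le hr1.le)
  have hm : seqComp F n z ∈ Metric.ball (0 : E) δ := by
    rw [mem_ball_zero_iff]; linarith
  have hq := quad_bound hδ hr h1 h2 h3 h4 hm
  have e : nrm F A (n + 1) z - nrm F A n z = (equivComp A (n + 1)).symm
      (F (n + 1) (seqComp F n z) - A (n + 1) (seqComp F n z)) := by
    rw [map_sub]
    congr 1
    show _ = (equivComp A n).symm ((A (n + 1)).symm (A (n + 1) (seqComp F n z)))
    rw [ContinuousLinearEquiv.symm_apply_apply]; rfl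
  rw [e]
  calc _ ≤ (s ^ (n + 1))⁻¹ * ‖F (n + 1) (seqComp F n z) - A (n + 1) (seqComp F n z)‖ :=
        h.symm_bound hδ hs _ _
    _ ≤ (s ^ (n + 1))⁻¹ * ((2 * r / δ) * (r ^ n * ‖z‖) ^ 2) := by
        gcongr
        refine hq.trans ?_
        gcongr
    _ = _ := by rw [div_pow]; field_simp; ring

/-- Uniform closeness to the identity. -/
theorem Good.near_id (h : Good s r δ F A) (hδ : 0 < δ) (hs : 0 < s) (hr : 0 < r) (hr1 : r < 1)
    (hr2 : r ^ 2 < s) (n : ℕ) {z : E} (hz : z ∈ Metric.ball (0 : E) δ) :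
    ‖nrm F A n z - z‖ ≤ 2 * r / δ / (s - r ^ 2) * ‖z‖ ^ 2 := by
  have hd : 0 < s - r ^ 2 := by linarith
  have key : ‖nrm F A n z - z‖
      ≤ 2 * r / δ / (s - r ^ 2) * ‖z‖ ^ 2 * (1 - (r ^ 2 / s) ^ n) := by
    induction n with
    | zero => simp [nrm, seqComp, equivComp]
    | succ n ih =>
      have h1 := h.step hδ hs hr hr1 n hz
      have h2 : nrm F A (n + 1) z - z
        = (nrm F A (n + 1) z - nrm F A n z) + (nrm F A n z - z) := by abel
      rw [h2]
      refine (norm_add_le _ _).trans ((add_le_add h1 ih).trans (le_of_eq ?_))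
      rw [pow_succ (r ^ 2 / s)]
      generalize (r ^ 2 / s) ^ n = Q
      field_simp
      ring
  refine key.trans (mul_le_of_le_one_right (by positivity) ?_)
  have : 0 ≤ (r ^ 2 / s) ^ n := by positivity
  linarith

/-- Uniform injectivity near the origin. -/
theorem exists_inj_radius (hδ : 0 < δ) (hs : 0 < s) (hr : 0 < r) (hr1 : r < 1)
    (hr2 : r ^ 2 < s) : ∃ ε > 0, ∀ (F : ℕ → E → E) (A : ℕ → E ≃L[ℂ] E), Good s r δ F A →
      ∀ n, ∀ x ∈ Metric.ball (0 : E) ε, ∀ y ∈ Metric.ball (0 : E) ε,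
        ‖x - y‖ ≤ 2 * ‖nrm F A n x - nrm F A n y‖ := by
  have hd : 0 < s - r ^ 2 := by linarith
  obtain ⟨D, hD⟩ : ∃ D, D = 2 * r / δ / (s - r ^ 2) := ⟨_, rfl⟩
  have hDpos : 0 < D := by rw [hD]; positivity
  -- work with balls of radius `ε` and `2 ε`
  obtain ⟨ε, hε, hε1, hε2⟩ : ∃ ε > 0, 2 * ε ≤ δ ∧ 16 * D * ε ≤ 1 := by
    refine ⟨min (δ / 2) (1 / (16 * D)), by positivity, ?_, ?_⟩
    · linarith [min_le_left (δ / 2) (1 / (16 * D))]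
    · have := min_le_right (δ / 2) (1 / (16 * D))
      rwa [le_div_iff₀ (by positivity), mul_comm] at this
  refine ⟨ε, hε, ?_⟩
  intro F A h n x hx y hy
  have hdiff : Differentiable ℂ (fun z => nrm F A n z - z) := (h.nrm_diff n).sub differentiable_id
  have hbd : ∀ z ∈ Metric.ball (0 : E) (2 * ε), ‖nrm F A n z - z‖ ≤ 4 * D * ε ^ 2 := by
    intro z hz
    have hz' : ‖z‖ < 2 * ε := by simpa using hz
    have := h.near_id hδ hs hr hr1 hr2 n (Metric.ball_subset_ball hε1 hz)
    rw [← hD] at this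
    refine this.trans ?_
    calc D * ‖z‖ ^ 2 ≤ D * (2 * ε) ^ 2 := by gcongr
      _ = _ := by ring
  have hfd : ∀ z ∈ Metric.ball (0 : E) ε, ‖fderiv ℂ (fun z => nrm F A n z - z) z‖ ≤ 1 / 2 := by
    intro z hz
    have hz' : ‖z‖ < ε := by simpa using hz
    have := Complex.norm_fderiv_le_div_of_mapsTo_ball (f := fun z => nrm F A n z - z) (c := z)
      (R₁ := ε) (R₂ := 8 * D * ε ^ 2) hdiff.differentiableOn (by
        intro w hw
        rw [mem_ball_iff_norm] at hw
        have hw' : w ∈ Metric.ball (0 : E) (2 * ε) := by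
          rw [mem_ball_zero_iff]
          have := norm_le_norm_add_norm_sub' w z
          linarith
        have h1 := hbd w hw'
        have h2 := hbd z (Metric.ball_subset_ball (by linarith) hz)
        rw [mem_closedBall_iff_norm]
        refine (norm_sub_le _ _).trans ?_
        linarith) hε
    refine this.trans ?_
    rw [div_le_iff₀ hε]
    nlinarith
  let _ : NormedSpace ℝ E := NormedSpace.restrictScalars ℝ ℂ E
  have hmv := (convex_ball (0 : E) ε).norm_image_sub_le_of_norm_fderiv_le (𝕜 := ℂ)
    (fun z _ => hdiff z) hfd hy hx
  have e : x - y = (nrm F A n x - nrm F A n y) - ((nrm F A n x - x) - (nrm F A n y - y)) := by abel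
  have := norm_sub_le (nrm F A n x - nrm F A n y) ((nrm F A n x - x) - (nrm F A n y - y))
  rw [← e] at this
  linarith

/-- Weierstrass theorem in several variables, at the centre of a ball. -/
theorem weierstrass [CompleteSpace E] {f : ℕ → E → E} {Φ : E → E} {z : E} {R : ℝ} (hR : 0 < R)
    (hf : ∀ n, Differentiable ℂ (f n)) (hu : TendstoUniformlyOn f Φ atTop (Metric.ball z R)) :
    ∃ L : E →L[ℂ] E, HasFDerivAt Φ L z ∧ Tendsto (fun n => fderiv ℂ (f n) z) atTop (𝓝 L) := by
  have hC : UniformCauchySeqOn (fun n => fderiv ℂ (f n)) atTop (Metric.ball z (R / 2)) := by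
    rw [Metric.uniformCauchySeqOn_iff]
    intro ε hε
    obtain ⟨N, hN⟩ := Metric.uniformCauchySeqOn_iff.1 hu.uniformCauchySeqOn (ε * R / 8)
      (by positivity)
    refine ⟨N, fun m hm n hn w hw => ?_⟩
    have hsub : Metric.ball w (R / 2) ⊆ Metric.ball z R := by
      apply Metric.ball_subset_ball'
      have : dist w z < R / 2 := hw
      linarith
    have := Complex.norm_fderiv_le_div_of_mapsTo_ball (f := fun z => f m z - f n z) (c := w)
      (R₁ := R / 2) (R₂ := ε * R / 4) ((hf m).sub (hf n)).differentiableOn (by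
        intro v hv
        have h1 := hN m hm n hn v (hsub hv)
        have h2 := hN m hm n hn w (hsub (Metric.mem_ball_self (by positivity)))
        rw [dist_eq_norm] at h1 h2
        rw [mem_closedBall_iff_norm]
        refine (norm_sub_le _ _).trans ?_
        linarith) (by positivity)
    rw [fderiv_fun_sub (hf m w) (hf n w)] at this
    rw [dist_eq_norm]
    refine this.trans_lt ?_
    rw [div_lt_iff₀ (by positivity)]
    nlinarith [mul_pos hε hR]
  have hlim : ∀ w ∈ Metric.ball z (R / 2),
      Tendsto (fun n => fderiv ℂ (f n) w) atTop
        (𝓝 (limUnder atTop (fun n => fderiv ℂ (f n) w))) :=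
    fun w hw => tendsto_nhds_limUnder (cauchySeq_tendsto_of_complete (hC.cauchySeq hw))
  have hz : z ∈ Metric.ball z (R / 2) := Metric.mem_ball_self (by positivity)
  refine ⟨_, ?_, hlim z hz⟩
  refine hasFDerivAt_of_tendstoUniformlyOn (g' := fun w => limUnder atTop
    (fun n => fderiv ℂ (f n) w)) Metric.isOpen_ball
    (hC.tendstoUniformlyOn_of_tendsto hlim) (fun n x _ => (hf n x).hasFDerivAt) ?_ hz
  intro x hx
  exact hu.tendsto_at (Metric.ball_subset_ball (by linarith) hx)

/-- Local uniform convergence near points of the basin. -/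
theorem Good.local_conv [CompleteSpace E] (h : Good s r δ F A) (hδ : 0 < δ) (hs : 0 < s)
    (hr : 0 < r) (hr1 : r < 1) (hr2 : r ^ 2 < s) {z : E} {m : ℕ}
    (hz : seqComp F m z ∈ Metric.ball (0 : E) δ) :
    ∃ R > 0, TendstoUniformlyOn (nrm F A)
      (fun z => limUnder atTop (fun n => nrm F A n z)) atTop (Metric.ball z R) := by
  obtain ⟨R, hR, hsub⟩ := Metric.isOpen_iff.1
    (Metric.isOpen_ball.preimage (h.seq_diff m).continuous) z hz
  refine ⟨R, hR, ?_⟩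
  have hq : r ^ 2 / s < 1 := by rwa [div_lt_one hs]
  obtain ⟨K, hK⟩ : ∃ K, K = (s ^ m)⁻¹ * (2 * r / δ / s * δ ^ 2) := ⟨_, rfl⟩
  have hstep : ∀ w ∈ Metric.ball z R, ∀ n,
      dist (nrm F A (m + n) w) (nrm F A (m + (n + 1)) w) ≤ K * (r ^ 2 / s) ^ n := by
    intro w hw n
    have hw' := hsub hw
    have hw2 : ‖seqComp F m w‖ < δ := by simpa using hw'
    rw [dist_comm, dist_eq_norm, nrm_add F A m (n + 1), nrm_add F A m n, ← map_sub]
    refine (h.symm_bound hδ hs _ _).trans ?_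
    rw [hK, mul_assoc]
    gcongr
    refine ((h.shift m).step hδ hs hr hr1 n hw').trans ?_
    gcongr
  have hlim : ∀ w ∈ Metric.ball z R, Tendsto (fun n => nrm F A (n + m) w) atTop
      (𝓝 (limUnder atTop (fun n => nrm F A n w))) := by
    intro w hw
    have h1 := cauchySeq_of_le_geometric _ _ hq (hstep w hw)
    obtain ⟨a, ha⟩ := cauchySeq_tendsto_of_complete h1
    have ha' : Tendsto (fun n => nrm F A (n + m) w) atTop (𝓝 a) := by
      simpa only [add_comm] using ha
    have ha2 := (tendsto_add_atTop_iff_nat (f := fun n => nrm F A n w) m).1 ha'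
    rw [ha2.limUnder_eq]
    exact ha'
  rw [Metric.tendstoUniformlyOn_iff]
  intro ε hε
  have ht : Tendsto (fun n : ℕ => K * (r ^ 2 / s) ^ n / (1 - r ^ 2 / s)) atTop (𝓝 0) := by
    have := ((tendsto_pow_atTop_nhds_zero_of_lt_one (by positivity) hq).const_mul K).div_const
      (1 - r ^ 2 / s)
    simpa using this
  obtain ⟨N, hN⟩ := eventually_atTop.1 (ht.eventually (gt_mem_nhds hε))
  filter_upwards [eventually_ge_atTop (m + N)] with n hn w hw
  obtain ⟨p, rfl⟩ := Nat.exists_eq_add_of_le (show m ≤ n by omega)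
  have hl : Tendsto (fun n => nrm F A (m + n) w) atTop
      (𝓝 (limUnder atTop (fun n => nrm F A n w))) := by
    simpa only [add_comm] using hlim w hw
  rw [dist_comm]
  exact (dist_le_of_le_geometric_of_tendsto _ _ hq (hstep w hw) hl p).trans_lt
    (hN p (by omega))

end Helpers

theorem normalized_compositions_converge_on_basin (k : ℕ) (hk : 2 ≤ k)
    (s r δ : ℝ) (hs : 0 < s) (hsr : s < r) (hr1 : r < 1) (hr2 : r ^ 2 < s) (hδ : 0 < δ)
    (F : ℕ → EuclideanSpace ℂ (Fin k) → EuclideanSpace ℂ (Fin k))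
    (hF : ∀ j, 1 ≤ j → IsAutomorphism (F j) ∧ F j 0 = 0 ∧
      ∀ z ∈ Metric.ball (0 : EuclideanSpace ℂ (Fin k)) δ,
        s * ‖z‖ ≤ ‖F j z‖ ∧ ‖F j z‖ ≤ r * ‖z‖) :
    ∃ A : ℕ → (EuclideanSpace ℂ (Fin k) ≃L[ℂ] EuclideanSpace ℂ (Fin k)),
      (∀ j, 1 ≤ j →
        (A j : EuclideanSpace ℂ (Fin k) →L[ℂ] EuclideanSpace ℂ (Fin k))
          = fderiv ℂ (F j) 0) ∧
      ∃ Φ : EuclideanSpace ℂ (Fin k) → EuclideanSpace ℂ (Fin k),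
        (∀ K ⊆ {z | Tendsto (fun j => seqComp F j z) atTop (nhds 0)}, IsCompact K →
          TendstoUniformlyOn (fun j z => (equivComp A j).symm (seqComp F j z)) Φ atTop K) ∧
        DifferentiableOn ℂ Φ {z | Tendsto (fun j => seqComp F j z) atTop (nhds 0)} ∧
        fderiv ℂ Φ 0 = ContinuousLinearMap.id ℂ (EuclideanSpace ℂ (Fin k)) ∧
        Set.InjOn Φ {z | Tendsto (fun j => seqComp F j z) atTop (nhds 0)} := by
  have hr : 0 < r := hs.trans hsr
  have hex : ∀ j, ∃ B : EuclideanSpace ℂ (Fin k) ≃L[ℂ] EuclideanSpace ℂ (Fin k), 1 ≤ j →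
      (B : EuclideanSpace ℂ (Fin k) →L[ℂ] EuclideanSpace ℂ (Fin k)) = fderiv ℂ (F j) 0 := by
    intro j
    by_cases hj : 1 ≤ j
    · obtain ⟨⟨hd, _⟩, h0, hb⟩ := hF j hj
      have hlow := fun v => (deriv_bounds hδ h0 (hd 0).hasFDerivAt hb v).1
      have hinj : Function.Injective
          (fderiv ℂ (F j) 0 : EuclideanSpace ℂ (Fin k) →ₗ[ℂ] EuclideanSpace ℂ (Fin k)) := by
        rw [injective_iff_map_eq_zero]
        intro v hv
        have hv' : fderiv ℂ (F j) 0 v = 0 := hv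
        have := hlow v
        rw [hv', norm_zero] at this
        rw [← norm_eq_zero]
        exact le_antisymm (by nlinarith [norm_nonneg v]) (norm_nonneg v)
      refine ⟨(LinearEquiv.ofInjectiveEndo _ hinj).toContinuousLinearEquiv, fun _ => ?_⟩
      ext v
      rfl
    · exact ⟨ContinuousLinearEquiv.refl ℂ _, fun h => absurd h hj⟩
  choose A hA using hex
  have hG : Good s r δ F A := by
    intro j hj
    obtain ⟨⟨hd, _⟩, h0, hb⟩ := hF j hj
    refine ⟨hd, h0, ?_, hb⟩
    rw [hA j hj]
    exact (hd 0).hasFDerivAt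
  have hinjF : ∀ n, Function.Injective (seqComp F n) := by
    intro n
    induction n with
    | zero => exact Function.injective_id
    | succ n ih =>
      obtain ⟨⟨_, G, _, hl, _⟩, _, _⟩ := hF (n + 1) (by omega)
      exact hl.injective.comp ih
  have hloc : ∀ z, Tendsto (fun j => seqComp F j z) atTop (nhds 0) →
      ∃ R > 0, TendstoUniformlyOn (nrm F A)
        (fun z => limUnder atTop (fun n => nrm F A n z)) atTop (Metric.ball z R) := by
    intro z hz
    obtain ⟨m, hm⟩ := (hz.eventually (Metric.ball_mem_nhds 0 hδ)).exists
    exact hG.local_conv hδ hs hr hr1 hr2 hm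
  refine ⟨A, hA, fun z => limUnder atTop (fun n => nrm F A n z), ?_, ?_, ?_, ?_⟩
  · intro K hK hKc
    rw [← tendstoLocallyUniformlyOn_iff_tendstoUniformlyOn_of_compact hKc]
    intro u hu z hz
    obtain ⟨R, hR, hRu⟩ := hloc z (hK hz)
    exact ⟨Metric.ball z R, mem_nhdsWithin_of_mem_nhds (Metric.ball_mem_nhds z hR), hRu u hu⟩
  · intro z hz
    obtain ⟨R, hR, hRu⟩ := hloc z hz
    obtain ⟨L, hL, _⟩ := weierstrass hR hG.nrm_diff hRu
    exact hL.differentiableAt.differentiableWithinAt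
  · obtain ⟨R, hR, hRu⟩ := hloc 0 (by simp [hG.seq_zero])
    obtain ⟨L, hL, ht⟩ := weierstrass hR hG.nrm_diff hRu
    rw [hL.fderiv]
    simp only [fun n => (hG.nrm_fderiv n).fderiv] at ht
    exact tendsto_nhds_unique ht tendsto_const_nhds
  · intro x hx y hy hxy
    obtain ⟨ε, hε, hinj⟩ := exists_inj_radius (E := EuclideanSpace ℂ (Fin k)) hδ hs hr hr1 hr2
    obtain ⟨m, hmx, hmy⟩ := ((hx.eventually (Metric.ball_mem_nhds 0 hε)).and
      (hy.eventually (Metric.ball_mem_nhds 0 hε))).exists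
    have hpt : ∀ z, Tendsto (fun j => seqComp F j z) atTop (nhds 0) →
        Tendsto (fun n => nrm F A n z) atTop
          (nhds (limUnder atTop (fun n => nrm F A n z))) := by
      intro z hz
      obtain ⟨R, hR, hRu⟩ := hloc z hz
      exact hRu.tendsto_at (Metric.mem_ball_self hR)
    have hdiff : Tendsto (fun n => nrm F A n x - nrm F A n y) atTop (nhds 0) := by
      have := (hpt x hx).sub (hpt y hy)
      have hxy' : limUnder atTop (fun n => nrm F A n x) = limUnder atTop (fun n => nrm F A n y) :=
        hxy
      rwa [hxy', sub_self] at this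
    have hdiff2 := (tendsto_add_atTop_iff_nat
      (f := fun n => nrm F A n x - nrm F A n y) m).2 hdiff
    have hdiff3 := (((equivComp A m).continuous.tendsto 0).comp hdiff2).norm.const_mul 2
    rw [map_zero, norm_zero, mul_zero] at hdiff3
    have hle : ‖seqComp F m x - seqComp F m y‖ ≤ 0 := by
      refine ge_of_tendsto' hdiff3 fun n => ?_
      have h1 := hinj _ _ (hG.shift m) n _ hmx _ hmy
      rw [Function.comp_apply, add_comm n m, nrm_add F A m n, nrm_add F A m n, map_sub,
        ContinuousLinearEquiv.apply_symm_apply, ContinuousLinearEquiv.apply_symm_apply]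
      exact h1
    exact hinjF m (sub_eq_zero.1 (norm_le_zero_iff.1 hle))
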